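/- Let n ≥ 3, m ≥ 2, and for each ε ∈ (0, 4/(n−2)) let u_ε be a radial Neumann solution with exactly m−1 interior zeros, with largest interior zero ρ_{1,ε}. Then there exist M > 1 and ε₀ ∈ (0, 4/(n−2)) such that for all ε ∈ (0, ε₀): |u_ε(1)| < M and ρ_{1,ε} < 1 − 1/M. -/

import Mathlib

open Real Set Filter Topology MeasureTheory

noncomputable section

/-- `κ_n = ((n-2)/4) · Γ(n/2)² / Γ(n)`. -/
def kappa (n : ℕ) : ℝ :=
  (((n : ℝ) - 2) / 4) * Real.Gamma ((n : ℝ) / 2) ^ 2 / Real.Gamma (n : ℝ)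

/-- `p_ε = (n+2)/(n-2) - ε`. -/
def pEps (n : ℕ) (ε : ℝ) : ℝ := ((n : ℝ) + 2) / ((n : ℝ) - 2) - ε

/-- `u ∈ C²([0,1])` is a radial solution of `-Δu = |u|^{p-1} u` on the unit ball of `ℝⁿ`,
written in the radial variable: `(r^{n-1} u')' = -|u|^{p-1} u · r^{n-1}` on `(0,1]`,
with `u'(0) = 0`. -/
def IsRadialSolution (n : ℕ) (p : ℝ) (u : ℝ → ℝ) : Prop :=
  ContDiffOn ℝ 2 u (Set.Icc 0 1) ∧ deriv u 0 = 0 ∧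
    ∀ r ∈ Set.Ioc (0 : ℝ) 1,
      deriv (fun s => s ^ (n - 1) * deriv u s) r = -(|u r| ^ (p - 1) * u r * r ^ (n - 1))

/-- Radial Dirichlet solution with exactly `m-1` interior zeros, together with the
decreasing enumeration of its zeros `ρ 1 = 1 > ρ 2 > … > ρ m > 0` in `(0,1]` and of its
critical points `1 > δ 1 > … > δ m = 0` in `[0,1]`, interlaced as
`0 = δ m < ρ m < δ (m-1) < … < δ 1 < ρ 1 = 1`. -/
def DirichletData (n : ℕ) (p : ℝ) (m : ℕ) (u : ℝ → ℝ) (ρ δ : ℕ → ℝ) : Prop :=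
  IsRadialSolution n p u ∧ u 1 = 0 ∧ ρ 1 = 1 ∧ δ m = 0 ∧
    (∀ k, 1 ≤ k → k ≤ m → δ k < ρ k) ∧
    (∀ k, 1 ≤ k → k + 1 ≤ m → ρ (k + 1) < δ k) ∧
    {r : ℝ | r ∈ Set.Ioc (0 : ℝ) 1 ∧ u r = 0} = ρ '' Set.Icc 1 m ∧
    {r : ℝ | r ∈ Set.Icc (0 : ℝ) 1 ∧ deriv u r = 0} = δ '' Set.Icc 1 m

/-- Radial Neumann solution with exactly `m-1` interior zeros, together with the
decreasing enumeration of its zeros `1 > ρ 1 > … > ρ (m-1) > 0` in `(0,1)` and of its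
critical points `δ 1 = 1 > δ 2 > … > δ m = 0` in `[0,1]`, interlaced as
`0 = δ m < ρ (m-1) < δ (m-1) < … < ρ 1 < δ 1 = 1`. -/
def NeumannData (n : ℕ) (p : ℝ) (m : ℕ) (u : ℝ → ℝ) (ρ δ : ℕ → ℝ) : Prop :=
  IsRadialSolution n p u ∧ deriv u 1 = 0 ∧ δ 1 = 1 ∧ δ m = 0 ∧
    (∀ k, 1 ≤ k → k ≤ m - 1 → ρ k < δ k) ∧
    (∀ k, 1 ≤ k → k ≤ m - 1 → δ (k + 1) < ρ k) ∧
    {r : ℝ | r ∈ Set.Ioo (0 : ℝ) 1 ∧ u r = 0} = ρ '' Set.Icc 1 (m - 1) ∧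
    {r : ℝ | r ∈ Set.Icc (0 : ℝ) 1 ∧ deriv u r = 0} = δ '' Set.Icc 1 m

/-- A nontrivial radial Dirichlet solution with exactly `m-1` interior zeros. -/
def DirichletSol (n : ℕ) (p : ℝ) (m : ℕ) (u : ℝ → ℝ) : Prop :=
  IsRadialSolution n p u ∧ u 1 = 0 ∧ (∃ r ∈ Set.Icc (0 : ℝ) 1, u r ≠ 0) ∧
    ∃ Z : Finset ℝ, (Z : Set ℝ) = {r | r ∈ Set.Ioo (0 : ℝ) 1 ∧ u r = 0} ∧ Z.card = m - 1

/-- A nontrivial radial Neumann solution with exactly `m-1` interior zeros. -/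
def NeumannSol (n : ℕ) (p : ℝ) (m : ℕ) (u : ℝ → ℝ) : Prop :=
  IsRadialSolution n p u ∧ deriv u 1 = 0 ∧ (∃ r ∈ Set.Icc (0 : ℝ) 1, u r ≠ 0) ∧
    ∃ Z : Finset ℝ, (Z : Set ℝ) = {r | r ∈ Set.Ioo (0 : ℝ) 1 ∧ u r = 0} ∧ Z.card = m - 1


/-- One-sided estimate on an interval where `u ≥ 0` is increasing. -/
lemma one_sided (u v w W : ℝ → ℝ) (k p x z : ℝ) (hk : 0 < k) (hk1 : k ≤ 1) (hp : 1 < p)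
    (hxz : x < z)
    (hu : ∀ r ∈ Icc x z, HasDerivAt u (v r) r)
    (hw : ∀ r ∈ Icc x z, HasDerivAt w (W r) r)
    (hW : ∀ r ∈ Icc x z, W r ≤ -(k * (u r) ^ p))
    (hu0 : ∀ r ∈ Icc x z, 0 ≤ u r)
    (hvw : ∀ r ∈ Icc x z, 0 ≤ w r → w r ≤ v r ∧ k * v r ≤ w r)
    (hwz : 0 ≤ w z) :
    w z * (z - x) ≤ u z ∧ (k * u z / 2) ^ p * k * ((z - x) / 2) ^ 2 ≤ u z := by
  have hanti : AntitoneOn w (Icc x z) := by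
    apply antitoneOn_of_deriv_nonpos (convex_Icc x z)
    · exact fun r hr => (hw r hr).continuousAt.continuousWithinAt
    · intro r hr
      exact (hw r (interior_subset hr)).differentiableAt.differentiableWithinAt
    · intro r hr
      rw [(hw r (interior_subset hr)).deriv]
      have h1 := hW r (interior_subset hr)
      have h2 := Real.rpow_nonneg (hu0 r (interior_subset hr)) p
      nlinarith [mul_nonneg hk.le h2]
  have hwpos : ∀ r ∈ Icc x z, 0 ≤ w r := fun r hr =>
    hwz.trans (hanti hr (right_mem_Icc.2 hxz.le) hr.2)
  have mvt : ∀ s t, x ≤ s → s < t → t ≤ z → ∃ c ∈ Ioo s t, u t - u s = v c * (t - s) := by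
    intro s t hs hst ht
    obtain ⟨c, hc, h⟩ := exists_hasDerivAt_eq_slope u v hst
      (fun r hr => (hu r ⟨hs.trans hr.1, hr.2.trans ht⟩).continuousAt.continuousWithinAt)
      (fun r hr => hu r ⟨hs.trans hr.1.le, hr.2.le.trans ht⟩)
    refine ⟨c, hc, ?_⟩
    rw [h]; field_simp [(sub_pos.2 hst).ne']
  have low : ∀ s t, x ≤ s → s < t → t ≤ z → w t * (t - s) ≤ u t - u s := by
    intro s t hs hst ht
    obtain ⟨c, hc, h⟩ := mvt s t hs hst ht
    have hcI : c ∈ Icc x z := ⟨hs.trans hc.1.le, hc.2.le.trans ht⟩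
    rw [h]
    apply mul_le_mul_of_nonneg_right _ (sub_pos.2 hst).le
    exact (hanti hcI ⟨hs.trans hst.le, ht⟩ hc.2.le).trans (hvw c hcI (hwpos c hcI)).1
  have hx0 := hu0 x (left_mem_Icc.2 hxz.le)
  refine ⟨by linarith [low x z le_rfl hxz le_rfl], ?_⟩
  set q := (x + z) / 2 with hq
  have hxq : x < q := by linarith
  have hqz : q < z := by linarith
  have hqI : q ∈ Icc x z := ⟨hxq.le, hqz.le⟩
  have hl := low x q le_rfl hxq hqz.le
  have hqlow : k * u z / 2 ≤ u q := by
    obtain ⟨c, hc, h⟩ := mvt q z hxq.le hqz le_rfl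
    have hcI : c ∈ Icc x z := ⟨hxq.le.trans hc.1.le, hc.2.le⟩
    have h1 := (hvw c hcI (hwpos c hcI)).2
    have h2 := hanti hqI hcI hc.1.le
    have h3 : k * (u z - u q) ≤ w q * (z - q) := by
      rw [h, ← mul_assoc]
      exact mul_le_mul_of_nonneg_right (h1.trans h2) (sub_pos.2 hqz).le
    have h4 : z - q = q - x := by rw [hq]; ring
    rw [h4] at h3
    have h5 := hu0 q hqI
    nlinarith
  have humono : ∀ r ∈ Icc q z, u q ≤ u r := by
    intro r hr
    rcases eq_or_lt_of_le hr.1 with h | h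
    · rw [h]
    · have h1 := low q r hxq.le h hr.2
      have h2 := hwpos r ⟨hxq.le.trans hr.1, hr.2⟩
      nlinarith
  have huz := hu0 z (right_mem_Icc.2 hxz.le)
  have hwq : k * (k * u z / 2) ^ p * (z - q) ≤ w q := by
    obtain ⟨c, hc, h⟩ := exists_hasDerivAt_eq_slope w W hqz
      (fun r hr => (hw r ⟨hxq.le.trans hr.1, hr.2⟩).continuousAt.continuousWithinAt)
      (fun r hr => hw r ⟨hxq.le.trans hr.1.le, hr.2.le⟩)
    have hcI : c ∈ Icc x z := ⟨hxq.le.trans hc.1.le, hc.2.le⟩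
    have h1 := hW c hcI
    have h2 : (k * u z / 2) ^ p ≤ (u c) ^ p :=
      Real.rpow_le_rpow (by positivity) (hqlow.trans (humono c ⟨hc.1.le, hc.2.le⟩)) (by linarith)
    have h3 : w z - w q = W c * (z - q) := by
      rw [h]; field_simp [(sub_pos.2 hqz).ne']
    have h4 : k * (k * u z / 2) ^ p ≤ - W c := by nlinarith
    have h5 := mul_le_mul_of_nonneg_right h4 (sub_pos.2 hqz).le
    linarith
  have h4 : z - q = (z - x) / 2 := by rw [hq]; ring
  have h6 : q - x = (z - x) / 2 := by rw [hq]; ring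
  rw [h4] at hwq
  rw [h6] at hl
  have h7 := mul_le_mul_of_nonneg_right hwq (by linarith : 0 ≤ (z - x) / 2)
  have h8 := humono z ⟨hqz.le, le_rfl⟩
  nlinarith

/-- The first order system satisfied by a radial solution and its derivative. -/
def Sys (N : ℕ) (p : ℝ) (u v : ℝ → ℝ) : Prop :=
  ContinuousOn u (Icc 0 1) ∧ ContinuousOn v (Icc 0 1) ∧
    (∀ r ∈ Ioo (0 : ℝ) 1, HasDerivAt u (v r) r) ∧
    ∀ r ∈ Ioo (0 : ℝ) 1, HasDerivAt v (-(|u r| ^ (p - 1) * u r) - N * v r / r) r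

lemma Sys.neg {N : ℕ} {p : ℝ} {u v : ℝ → ℝ} (h : Sys N p u v) :
    Sys N p (fun r => - u r) (fun r => - v r) := by
  obtain ⟨h1, h2, h3, h4⟩ := h
  refine ⟨h1.neg, h2.neg, fun r hr => (h3 r hr).neg, fun r hr => ?_⟩
  refine (h4 r hr).neg.congr_deriv ?_
  rw [abs_neg]; ring

lemma Sys.w {N : ℕ} {p : ℝ} {u v : ℝ → ℝ} (h : Sys N p u v) (r : ℝ) (hr : r ∈ Ioo (0 : ℝ) 1) :
    HasDerivAt (fun s => s ^ N * v s) (-(|u r| ^ (p - 1) * u r * r ^ N)) r := by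
  have h1 := (hasDerivAt_pow N r).mul (h.2.2.2 r hr)
  refine h1.congr_deriv ?_
  have hr0 : r ≠ 0 := hr.1.ne'
  rcases N with _ | N
  · simp
  · simp only [Nat.add_sub_cancel]
    field_simp
    ring

lemma sys_of_sol {n : ℕ} {p : ℝ} {u : ℝ → ℝ} (h : IsRadialSolution n p u) :
    Sys (n - 1) p u (derivWithin u (Icc 0 1)) := by
  obtain ⟨hc, -, he⟩ := h
  have hv : ContDiffOn ℝ 1 (derivWithin u (Icc 0 1)) (Icc 0 1) :=
    hc.derivWithin (uniqueDiffOn_Icc zero_lt_one) (by norm_num)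
  have hd : ∀ r ∈ Ioo (0 : ℝ) 1, HasDerivAt u (derivWithin u (Icc 0 1) r) r := by
    intro r hr
    have h1 : DifferentiableWithinAt ℝ u (Icc 0 1) r :=
      (hc.differentiableOn (by norm_num)) r (Ioo_subset_Icc_self hr)
    exact h1.hasDerivWithinAt.hasDerivAt (Icc_mem_nhds hr.1 hr.2)
  refine ⟨hc.continuousOn, hv.continuousOn, hd, fun r hr => ?_⟩
  have h1 : DifferentiableAt ℝ (derivWithin u (Icc 0 1)) r :=
    ((hv.differentiableOn (by norm_num)) r (Ioo_subset_Icc_self hr)).differentiableAt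
      (Icc_mem_nhds hr.1 hr.2)
  have h2 := h1.hasDerivAt
  have h3 := (hasDerivAt_pow (n - 1) r).mul h2
  have h4 : (fun s => s ^ (n - 1) * deriv u s) =ᶠ[𝓝 r]
      ((fun s => s ^ (n - 1)) * derivWithin u (Icc 0 1)) := by
    filter_upwards [Ioo_mem_nhds hr.1 hr.2] with s hs
    simp [(hd s hs).deriv]
  have h5 := (h3.congr_of_eventuallyEq h4).deriv
  rw [he r ⟨hr.1, hr.2.le⟩] at h5
  refine h2.congr_deriv ?_
  have hr0 : 0 < r := hr.1
  have hrp : 0 < r ^ (n - 1) := pow_pos hr0 _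
  apply mul_left_cancel₀ hrp.ne'
  have h6 : r ^ (n - 1) * (((n - 1 : ℕ) : ℝ) * derivWithin u (Icc 0 1) r / r) =
      ((n - 1 : ℕ) : ℝ) * r ^ (n - 1 - 1) * derivWithin u (Icc 0 1) r := by
    rcases (n - 1) with _ | N
    · simp
    · simp only [Nat.add_sub_cancel]
      field_simp
      ring
  rw [mul_sub, h6]
  linarith

lemma abs_rpow_mul_self {p a : ℝ} (hp : 1 < p) (ha : 0 ≤ a) : |a| ^ (p - 1) * a = a ^ p := by
  rw [abs_of_nonneg ha]
  rcases eq_or_lt_of_le ha with h | h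
  · subst h; rw [Real.zero_rpow (by linarith : p ≠ 0)]; simp
  · rw [Real.rpow_sub_one h.ne']; field_simp

/-- Energy decreases. -/
lemma Sys.energy {N : ℕ} {p : ℝ} {u v : ℝ → ℝ} (h : Sys N p u v) (hp : 1 < p) :
    AntitoneOn (fun r => v r ^ 2 / 2 + |u r| ^ (p + 1) / (p + 1)) (Icc (1 / 2) 1) := by
  obtain ⟨h1, h2, h3, h4⟩ := h
  have hsub : Icc (1 / 2 : ℝ) 1 ⊆ Icc 0 1 := Icc_subset_Icc (by norm_num) le_rfl
  have hD : ∀ r ∈ interior (Icc (1 / 2 : ℝ) 1), HasDerivAt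
      (fun r => v r ^ 2 / 2 + |u r| ^ (p + 1) / (p + 1)) (-(N * v r ^ 2 / r)) r := by
    intro r hr
    rw [interior_Icc] at hr
    have hr' : r ∈ Ioo (0 : ℝ) 1 := ⟨by linarith [hr.1], hr.2⟩
    have a1 := ((h4 r hr').pow 2).div_const 2
    have a2 := ((hasDerivAt_abs_rpow (u r) (by linarith : 1 < p + 1)).comp r
      (h3 r hr')).div_const (p + 1)
    refine (a1.add a2).congr_deriv ?_
    have e : p + 1 - 2 = p - 1 := by ring
    rw [e]
    have hp0 : p + 1 ≠ 0 := by linarith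
    have hr0 := hr'.1.ne'
    field_simp
    push_cast
    ring
  apply antitoneOn_of_deriv_nonpos (convex_Icc _ _)
  · have c1 := h1.mono hsub
    have c2 := h2.mono hsub
    exact ((c2.pow 2).div_const 2).add
      ((c1.abs.rpow_const (fun x _ => Or.inr (by linarith))).div_const _)
  · exact fun r hr => (hD r hr).differentiableAt.differentiableWithinAt
  · intro r hr
    rw [(hD r hr).deriv]
    rw [interior_Icc] at hr
    have : 0 < r := by linarith [hr.1]
    have : 0 ≤ N * v r ^ 2 / r := by positivity
    linarith

/-- Bound for `u`, `w` at the midpoint of an interval where `u ≥ 0`. -/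
lemma Sys.mid {N : ℕ} {p : ℝ} {u v : ℝ → ℝ} (h : Sys N p u v) (hp : 1 < p) (c l : ℝ) (hl : 0 < l)
    (ha : 1 / 2 ≤ c - l) (hb : c + l < 1) (hu0 : ∀ r ∈ Icc (c - l) (c + l), 0 ≤ u r) :
    (1 / 2) ^ N * |v c| * l ≤ u c ∧
      ((1 / 2) ^ N * u c / 2) ^ p * (1 / 2) ^ N * (l / 2) ^ 2 ≤ u c := by
  have hk : (0 : ℝ) < (1 / 2) ^ N := by positivity
  have hk1 : ((1 : ℝ) / 2) ^ N ≤ 1 := pow_le_one₀ (by norm_num) (by norm_num)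
  have hI : ∀ r ∈ Icc (c - l) (c + l), r ∈ Ioo (0 : ℝ) 1 :=
    fun r hr => ⟨by linarith [hr.1], by linarith [hr.2]⟩
  have hrN : ∀ r ∈ Icc (c - l) (c + l), ((1 : ℝ) / 2) ^ N ≤ r ^ N ∧ r ^ N ≤ 1 := fun r hr =>
    ⟨pow_le_pow_left₀ (by norm_num) (by linarith [hr.1]) N,
      pow_le_one₀ (hI r hr).1.le (hI r hr).2.le⟩
  have hcI : c ∈ Icc (c - l) (c + l) := ⟨by linarith, by linarith⟩
  have hWb : ∀ r ∈ Icc (c - l) (c + l),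
      -(|u r| ^ (p - 1) * u r * r ^ N) ≤ -((1 / 2) ^ N * u r ^ p) := by
    intro r hr
    rw [abs_rpow_mul_self hp (hu0 r hr)]
    have := Real.rpow_nonneg (hu0 r hr) p
    nlinarith [(hrN r hr).1]
  have hvw : ∀ r ∈ Icc (c - l) (c + l), ∀ t : ℝ, 0 ≤ r ^ N * t →
      r ^ N * t ≤ t ∧ (1 / 2) ^ N * t ≤ r ^ N * t := by
    intro r hr t ht
    have h1 := hrN r hr
    have h2 : 0 < r ^ N := hk.trans_le h1.1
    have h3 : 0 ≤ t := nonneg_of_mul_nonneg_right ht h2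
    exact ⟨by nlinarith, by nlinarith⟩
  have hcN := hrN c hcI
  have hcp : 0 < c ^ N := hk.trans_le hcN.1
  rcases le_total 0 (v c) with hv | hv
  · have hsub : Icc (c - l) c ⊆ Icc (c - l) (c + l) := Icc_subset_Icc le_rfl (by linarith)
    have := one_sided u v (fun s => s ^ N * v s) (fun r => -(|u r| ^ (p - 1) * u r * r ^ N))
      ((1 / 2) ^ N) p (c - l) c hk hk1 hp (by linarith)
      (fun r hr => h.2.2.1 r (hI r (hsub hr))) (fun r hr => h.w r (hI r (hsub hr)))
      (fun r hr => hWb r (hsub hr)) (fun r hr => hu0 r (hsub hr))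
      (fun r hr => hvw r (hsub hr) (v r)) (by positivity)
    rw [show c - (c - l) = l by ring] at this
    refine ⟨?_, this.2⟩
    rw [abs_of_nonneg hv]
    refine le_trans ?_ this.1
    apply mul_le_mul_of_nonneg_right _ hl.le
    exact mul_le_mul_of_nonneg_right hcN.1 hv
  · have hsub : ∀ r ∈ Icc (-c - l) (-c), -r ∈ Icc (c - l) (c + l) :=
      fun r hr => ⟨by linarith [hr.2], by linarith [hr.1]⟩
    have := one_sided (fun s => u (-s)) (fun s => - v (-s)) (fun s => -((-s) ^ N * v (-s)))
      (fun r => -(|u (-r)| ^ (p - 1) * u (-r) * (-r) ^ N))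
      ((1 / 2) ^ N) p (-c - l) (-c) hk hk1 hp (by linarith)
      (fun r hr => by
        have h1 := h.2.2.1 (-r) (hI _ (hsub r hr))
        exact (h1.comp r (hasDerivAt_neg r)).congr_deriv (by ring))
      (fun r hr => by
        have h1 := (h.w (-r) (hI _ (hsub r hr)))
        exact (h1.comp r (hasDerivAt_neg r)).neg.congr_deriv (by ring))
      (fun r hr => hWb _ (hsub r hr)) (fun r hr => hu0 _ (hsub r hr))
      (fun r hr => by
        have h1 := hvw _ (hsub r hr) (- v (-r))
        simpa only [mul_neg] using h1)
      (by
        simp only [neg_neg]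
        nlinarith)
    simp only [neg_neg] at this
    rw [show -c - (-c - l) = l by ring] at this
    refine ⟨?_, this.2⟩
    rw [abs_of_nonpos hv]
    refine le_trans ?_ this.1
    apply mul_le_mul_of_nonneg_right _ hl.le
    nlinarith [hcN.1]

/-- The a priori bound on `u` from a zero-free interval. -/
lemma Sys.bound_aux {N n : ℕ} {p : ℝ} {u v : ℝ → ℝ} (h : Sys N p u v) (hp : 1 < p) (hp5 : p ≤ 5)
    (hnp : 1 ≤ (p - 1) * n)
    (c l k D K : ℝ) (hl : 0 < l)
    (ha : 1 / 2 ≤ c - l) (hb : c + l < 1) (hu0 : ∀ r ∈ Icc (c - l) (c + l), 0 ≤ u r)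
    (hk : k = (1 / 2) ^ N) (hD : D = 2 / (k * k * (l / 2) ^ 2))
    (hK : K = 2 * D ^ n / k / (k * l)) :
    ∀ r ∈ Icc c 1, |u r| ≤ 4 * K ^ 6 := by
  have hk0 : 0 < k := by rw [hk]; positivity
  have hk1 : k ≤ 1 := by rw [hk]; exact pow_le_one₀ (by norm_num) (by norm_num)
  have hl1 : l ≤ 1 := by linarith
  obtain ⟨m1, m2⟩ := h.mid hp c l hl ha hb hu0
  rw [← hk] at m1 m2
  have hD1 : 1 ≤ D := by
    rw [hD, le_div_iff₀ (by positivity)]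
    have : k * k ≤ 1 := by nlinarith
    have : (l / 2) ^ 2 ≤ 1 := by nlinarith
    nlinarith [mul_pos hk0 hk0]
  have huc := hu0 c ⟨by linarith, by linarith⟩
  have hDn : 1 ≤ D ^ n := one_le_pow₀ hD1
  -- bound of `y`
  have hy : k * u c / 2 ≤ D ^ n := by
    set y := k * u c / 2 with hyd
    rcases le_total y 1 with h1 | h1
    · exact h1.trans hDn
    · have hy0 : 0 < y := by linarith
      have e1 : y ^ p = y ^ (p - 1) * y := by
        rw [Real.rpow_sub_one hy0.ne']; field_simp
      have e2 : u c = 2 * y / k := by rw [hyd]; field_simp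
      have e3 : y ^ (p - 1) ≤ D := by
        rw [hD, le_div_iff₀ (by positivity)]
        rw [e1, e2, le_div_iff₀ hk0] at m2
        have : y * (y ^ (p - 1) * (k * k * (l / 2) ^ 2)) ≤ y * 2 := by nlinarith
        exact le_of_mul_le_mul_left this hy0
      calc y = y ^ (1 : ℝ) := (Real.rpow_one y).symm
        _ ≤ y ^ ((p - 1) * n) := Real.rpow_le_rpow_of_exponent_le h1 hnp
        _ = (y ^ (p - 1)) ^ n := by rw [Real.rpow_mul hy0.le, Real.rpow_natCast]
        _ ≤ D ^ n := pow_le_pow_left₀ (by positivity) e3 n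
  have hkl : k * l ≤ 1 := by nlinarith
  have hkl0 : 0 < k * l := by positivity
  have hB : u c ≤ 2 * D ^ n / k := by
    rw [le_div_iff₀ hk0]; linarith
  have hB1 : 1 ≤ 2 * D ^ n / k := by
    rw [le_div_iff₀ hk0]; linarith
  have hBK : 2 * D ^ n / k ≤ K := by
    rw [hK, le_div_iff₀ hkl0]; nlinarith
  have hK1 : 1 ≤ K := hB1.trans hBK
  have huK : u c ≤ K := hB.trans hBK
  have hvK : |v c| ≤ K := by
    rw [hK, le_div_iff₀ hkl0]; nlinarith
  intro r hr
  have hE := h.energy hp (⟨by linarith, by linarith⟩ : c ∈ Icc (1 / 2 : ℝ) 1)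
    (⟨by linarith [hr.1], hr.2⟩ : r ∈ Icc (1 / 2 : ℝ) 1) hr.1
  simp only at hE
  have hK6 : 1 ≤ K ^ 6 := one_le_pow₀ hK1
  rcases le_total |u r| 1 with h1 | h1
  · linarith
  · have hp1 : 0 < p + 1 := by linarith
    have e1 : |u r| ^ (p + 1) ≤ (p + 1) / 2 * v c ^ 2 + |u c| ^ (p + 1) := by
      have h2 : |u r| ^ (p + 1) / (p + 1) ≤ v c ^ 2 / 2 + |u c| ^ (p + 1) / (p + 1) := by
        nlinarith [sq_nonneg (v r)]
      rw [div_le_iff₀ hp1] at h2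
      have h3 : (v c ^ 2 / 2 + |u c| ^ (p + 1) / (p + 1)) * (p + 1) =
        (p + 1) / 2 * v c ^ 2 + |u c| ^ (p + 1) := by field_simp
      linarith
    have e2 : |u c| ^ (p + 1) ≤ K ^ 6 := by
      rw [abs_of_nonneg huc]
      calc (u c) ^ (p + 1) ≤ K ^ (p + 1) := Real.rpow_le_rpow huc huK hp1.le
        _ ≤ K ^ ((6 : ℕ) : ℝ) :=
          Real.rpow_le_rpow_of_exponent_le hK1 (by push_cast; linarith)
        _ = K ^ 6 := Real.rpow_natCast _ _
    have e3 : v c ^ 2 ≤ K ^ 6 := by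
      rw [← sq_abs]
      exact (pow_le_pow_left₀ (abs_nonneg _) hvK 2).trans (pow_le_pow_right₀ hK1 (by norm_num))
    have e4 : |u r| ≤ |u r| ^ (p + 1) := by
      calc |u r| = |u r| ^ (1 : ℝ) := (Real.rpow_one _).symm
        _ ≤ _ := Real.rpow_le_rpow_of_exponent_le h1 (by linarith)
    nlinarith [sq_nonneg (v c)]

/-- The same bound when `u` merely has no zero on the interval. -/
lemma Sys.bound {N n : ℕ} {p : ℝ} {u v : ℝ → ℝ} (h : Sys N p u v) (hp : 1 < p) (hp5 : p ≤ 5)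
    (hnp : 1 ≤ (p - 1) * n)
    (c l k D K : ℝ) (hl : 0 < l)
    (ha : 1 / 2 ≤ c - l) (hb : c + l < 1) (hu0 : ∀ r ∈ Icc (c - l) (c + l), u r ≠ 0)
    (hk : k = (1 / 2) ^ N) (hD : D = 2 / (k * k * (l / 2) ^ 2))
    (hK : K = 2 * D ^ n / k / (k * l)) :
    ∀ r ∈ Icc c 1, |u r| ≤ 4 * K ^ 6 := by
  have hcont : ContinuousOn u (Icc (c - l) (c + l)) :=
    h.1.mono (Icc_subset_Icc (by linarith) (by linarith))
  have hsign : (∀ r ∈ Icc (c - l) (c + l), 0 ≤ u r) ∨ (∀ r ∈ Icc (c - l) (c + l), u r ≤ 0) := by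
    by_contra hcon
    push Not at hcon
    obtain ⟨⟨r, hr, h1⟩, ⟨s, hs, h2⟩⟩ := hcon
    obtain ⟨t, ht, h3⟩ := isPreconnected_Icc.intermediate_value hr hs hcont ⟨h1.le, h2.le⟩
    exact hu0 t ht h3
  rcases hsign with h1 | h1
  · exact h.bound_aux hp hp5 hnp c l k D K hl ha hb h1 hk hD hK
  · have := h.neg.bound_aux hp hp5 hnp c l k D K hl ha hb
      (fun r hr => neg_nonneg.2 (h1 r hr)) hk hD hK
    simpa only [abs_neg] using this

/-- Lower bound for the distance of the last zero to `1`. -/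
lemma Sys.gap {N : ℕ} {p : ℝ} {u v : ℝ → ℝ} (h : Sys N p u v) (hp : 1 < p) (hp5 : p ≤ 5)
    (z K : ℝ) (hz : 1 / 2 ≤ z) (hz1 : z < 1) (huz : u z = 0) (hu1 : u 1 ≠ 0) (hv1 : v 1 = 0)
    (hK1 : 1 ≤ K) (hK : ∀ r ∈ Icc z 1, |u r| ≤ K) :
    (1 / 2) ^ N ≤ K ^ 4 * (1 - z) := by
  have hsub : Icc z 1 ⊆ Icc 0 1 := Icc_subset_Icc (by linarith) le_rfl
  have cu := h.1.mono hsub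
  have cv := h.2.1.mono hsub
  obtain ⟨x, hx, hmax⟩ := isCompact_Icc.exists_isMaxOn (nonempty_Icc.2 hz1.le) cu.abs
  set S := |u x| with hS
  have hmax' : ∀ r ∈ Icc z 1, |u r| ≤ S := fun r hr => hmax hr
  have hS0 : 0 < S := (abs_pos.2 hu1).trans_le (hmax' 1 ⟨hz1.le, le_rfl⟩)
  have hSK : S ≤ K := hK x hx
  have hk : (0 : ℝ) < (1 / 2) ^ N := by positivity
  have hv : ∀ r ∈ Ioo z 1, (1 / 2) ^ N * |v r| ≤ S ^ (p - 1) * S * (1 - z) := by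
    intro r hr
    have hsub' : Icc r 1 ⊆ Icc 0 1 := Icc_subset_Icc (by linarith [hr.1]) le_rfl
    obtain ⟨y, hy, e⟩ := exists_hasDerivAt_eq_slope (fun s => s ^ N * v s)
      (fun r => -(|u r| ^ (p - 1) * u r * r ^ N)) hr.2
      ((continuous_pow N).continuousOn.mul (h.2.1.mono hsub'))
      (fun s hs => h.w s ⟨by linarith [hs.1, hr.1], hs.2⟩)
    simp only [hv1, mul_zero, zero_sub] at e
    have h1r : 0 < 1 - r := sub_pos.2 hr.2
    have e2 : r ^ N * v r = |u y| ^ (p - 1) * u y * y ^ N * (1 - r) := by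
      field_simp at e
      linarith
    have hr0 : 0 < r := by linarith [hr.1]
    have hy0 : 0 < y := hr0.trans hy.1
    have e3 : r ^ N * |v r| = |u y| ^ (p - 1) * |u y| * y ^ N * (1 - r) := by
      have := congrArg abs e2
      rw [abs_mul, abs_mul, abs_mul, abs_mul, abs_of_pos (pow_pos hr0 N),
        abs_of_pos (pow_pos hy0 N), abs_of_pos h1r,
        abs_of_nonneg (Real.rpow_nonneg (abs_nonneg (u y)) _)] at this
      exact this
    have hySu := hmax' y ⟨hr.1.le.trans hy.1.le, hy.2.le⟩
    calc (1 / 2) ^ N * |v r| ≤ r ^ N * |v r| :=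
          mul_le_mul_of_nonneg_right
            (pow_le_pow_left₀ (by norm_num) (by linarith [hr.1]) N) (abs_nonneg _)
      _ = |u y| ^ (p - 1) * |u y| * y ^ N * (1 - r) := e3
      _ ≤ S ^ (p - 1) * S * 1 * (1 - z) := by
          have i1 : |u y| ^ (p - 1) ≤ S ^ (p - 1) :=
            Real.rpow_le_rpow (abs_nonneg _) hySu (by linarith)
          have i2 : y ^ N ≤ 1 := pow_le_one₀ hy0.le hy.2.le
          have i3 : 1 - r ≤ 1 - z := by linarith [hr.1]
          gcongr
      _ = _ := by ring
  have hxz : z < x := by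
    rcases eq_or_lt_of_le hx.1 with h1 | h1
    · rw [hS, ← h1, huz, abs_zero] at hS0; exact absurd hS0 (lt_irrefl _)
    · exact h1
  obtain ⟨y, hy, e⟩ := exists_hasDerivAt_eq_slope u v hxz
    (cu.mono (Icc_subset_Icc le_rfl hx.2))
    (fun s hs => h.2.2.1 s ⟨by linarith [hs.1], by linarith [hs.2, hx.2]⟩)
  rw [huz, sub_zero] at e
  have hxz0 : 0 < x - z := sub_pos.2 hxz
  have e1 : u x = v y * (x - z) := by rw [e]; field_simp
  have e2 : S = |v y| * (x - z) := by rw [hS, e1, abs_mul, abs_of_pos hxz0]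
  have hvy := hv y ⟨hy.1, hy.2.trans_le hx.2⟩
  have i1 : S ≤ |v y| * 1 := by
    rw [e2]
    exact mul_le_mul_of_nonneg_left (by linarith [hx.2]) (abs_nonneg _)
  have i2 : S ^ (p - 1) ≤ K ^ 4 := by
    calc S ^ (p - 1) ≤ K ^ (p - 1) := Real.rpow_le_rpow hS0.le hSK (by linarith)
      _ ≤ K ^ ((4 : ℕ) : ℝ) := Real.rpow_le_rpow_of_exponent_le hK1 (by push_cast; linarith)
      _ = K ^ 4 := Real.rpow_natCast _ _
  have i3 : S * (1 / 2) ^ N ≤ S * (S ^ (p - 1) * (1 - z)) := by nlinarith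
  have i4 := le_of_mul_le_mul_left i3 hS0
  exact i4.trans (mul_le_mul_of_nonneg_right i2 (by linarith))

lemma delta_mono {m : ℕ} {ρ δ : ℕ → ℝ}
    (h1 : ∀ k, 1 ≤ k → k ≤ m - 1 → ρ k < δ k)
    (h2 : ∀ k, 1 ≤ k → k ≤ m - 1 → δ (k + 1) < ρ k) :
    ∀ k, 2 ≤ k → k ≤ m → δ k < ρ 1 := by
  intro k hk
  induction k, hk using Nat.le_induction with
  | base => intro h; exact h2 1 le_rfl (by omega)
  | succ k hk ih =>
    intro h
    have a := ih (by omega)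
    have b := h1 k (by omega) (by omega)
    have c := h2 k (by omega) (by omega)
    linarith

lemma rho_mono {m : ℕ} {ρ δ : ℕ → ℝ}
    (h1 : ∀ k, 1 ≤ k → k ≤ m - 1 → ρ k < δ k) :
    1 ≤ m - 1 → ρ 1 < δ 1 := fun h => h1 1 le_rfl h

/-- Neumann data: `u 1 ≠ 0` and the one-sided derivative vanishes at `1`. -/
lemma neumann_end {n m : ℕ} {p : ℝ} {u : ℝ → ℝ} {ρ δ : ℕ → ℝ} (hm : 2 ≤ m)
    (h : NeumannData n p m u ρ δ) : u 1 ≠ 0 ∧ derivWithin u (Icc 0 1) 1 = 0 := by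
  obtain ⟨hs, hd1, hδ1, -, ho1, ho2, hZ, hC⟩ := h
  have hρmem : ρ 1 ∈ {r : ℝ | r ∈ Set.Ioo (0 : ℝ) 1 ∧ u r = 0} := by
    rw [hZ]; exact ⟨1, ⟨le_rfl, by omega⟩, rfl⟩
  have sys := sys_of_sol hs
  have hu1 : u 1 ≠ 0 := by
    intro hu1
    obtain ⟨c, hc, hc0⟩ := exists_deriv_eq_zero hρmem.1.2
      (sys.1.mono (Icc_subset_Icc hρmem.1.1.le le_rfl)) (hρmem.2.trans hu1.symm)
    have : c ∈ {r : ℝ | r ∈ Set.Icc (0 : ℝ) 1 ∧ deriv u r = 0} :=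
      ⟨⟨hρmem.1.1.le.trans hc.1.le, hc.2.le⟩, hc0⟩
    rw [hC] at this
    obtain ⟨k, hk, rfl⟩ := this
    rcases eq_or_lt_of_le hk.1 with h1 | h1
    · rw [← h1, hδ1] at hc; exact lt_irrefl _ hc.2
    · exact lt_asymm (delta_mono ho1 ho2 k h1 hk.2) hc.1
  refine ⟨hu1, ?_⟩
  have he := hs.2.2 1 ⟨one_pos, le_rfl⟩
  have hne : deriv (fun s => s ^ (n - 1) * deriv u s) 1 ≠ 0 := by
    rw [he]
    have : 0 < |u 1| ^ (p - 1) := Real.rpow_pos_of_pos (abs_pos.2 hu1) _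
    simp [this.ne', hu1]
  have hcont := (differentiableAt_of_deriv_ne_zero hne).continuousAt
  have t1 : Tendsto (fun s => s ^ (n - 1) * deriv u s) (𝓝[<] 1) (𝓝 0) := by
    have := hcont.tendsto
    simp only [hd1, mul_zero] at this
    exact this.mono_left nhdsWithin_le_nhds
  have t2 : Tendsto (fun s => s ^ (n - 1) * derivWithin u (Icc 0 1) s) (𝓝[<] 1)
      (𝓝 (1 ^ (n - 1) * derivWithin u (Icc 0 1) 1)) := by
    have c1 : ContinuousWithinAt (derivWithin u (Icc 0 1)) (Icc 0 1) 1 :=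
      sys.2.1 1 ⟨zero_le_one, le_rfl⟩
    have c2 : ContinuousWithinAt (fun s : ℝ => s ^ (n - 1) * derivWithin u (Icc 0 1) s)
      (Icc 0 1) 1 := (continuous_pow (n - 1)).continuousWithinAt.mul c1
    have c3 := c2.mono Ioo_subset_Icc_self
    have c4 : 𝓝[Ioo (0 : ℝ) 1] 1 = 𝓝[<] 1 := nhdsWithin_Ioo_eq_nhdsLT one_pos
    rw [ContinuousWithinAt, c4] at c3
    exact c3
  have t3 : (fun s => s ^ (n - 1) * derivWithin u (Icc 0 1) s) =ᶠ[𝓝[<] 1]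
      (fun s => s ^ (n - 1) * deriv u s) := by
    filter_upwards [Ioo_mem_nhdsLT (one_pos : (0 : ℝ) < 1)] with s hs'
    rw [(sys.2.2.1 s hs').deriv]
  have := tendsto_nhds_unique (t2.congr' t3) t1
  simpa using this

/-- Pigeonhole: one of `m` disjoint intervals in `[1/2,3/4]` is free of zeros. -/
lemma exists_free {m : ℕ} (hm : 2 ≤ m) (ρ : ℕ → ℝ) : ∃ c : ℝ, 1 / 2 ≤ c - 1 / (16 * m) ∧
    c + 1 / (16 * m) ≤ 3 / 4 ∧
    ∀ r ∈ Icc (c - 1 / (16 * m)) (c + 1 / (16 * m)), r ∉ ρ '' Icc 1 (m - 1) := by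
  have hm0 : (0 : ℝ) < m := by exact_mod_cast (by omega : 0 < m)
  set d : ℝ := 1 / (16 * m) with hd
  have hd0 : 0 < d := by positivity
  have hdm : d * m = 1 / 16 := by rw [hd]; field_simp
  by_contra hcon
  push Not at hcon
  have hj : ∀ j : ℕ, j < m → ∃ k ∈ Icc 1 (m - 1), 1 / 2 + 4 * d * j ≤ ρ k ∧
      ρ k ≤ 1 / 2 + 4 * d * j + 2 * d := by
    intro j hj
    have hj0 : (0 : ℝ) ≤ j := Nat.cast_nonneg j
    have hj1 : (j : ℝ) + 1 ≤ m := by exact_mod_cast hj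
    obtain ⟨r, hr, k, hk, rfl⟩ := hcon (1 / 2 + 4 * d * j + d)
      (by nlinarith [mul_nonneg hd0.le hj0]) (by nlinarith)
    exact ⟨k, hk, by linarith [hr.1], by linarith [hr.2]⟩
  choose! f hf1 hf2 hf3 using hj
  obtain ⟨i, hi, j, hj, hij, he⟩ := Finset.exists_ne_map_eq_of_card_lt_of_maps_to
    (s := Finset.range m) (t := Finset.Icc 1 (m - 1)) (f := f)
    (by simp; omega)
    (fun j hj => by
      have := hf1 j (Finset.mem_range.1 hj)
      simpa using this)
  rw [Finset.mem_range] at hi hj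
  have key : ∀ i j, i < m → j < m → f i = f j → i < j → False := by
    intro i j hi hj he hlt
    have h1 := hf3 i hi
    have h2 := hf2 j hj
    rw [he] at h1
    have h3 : (i : ℝ) + 1 ≤ j := by exact_mod_cast hlt
    nlinarith
  rcases lt_or_gt_of_ne hij with h | h
  · exact key i j hi hj he h
  · exact key j i hj hi he.symm h

/-- **Lemma 3.4.** For radial Neumann solutions with `m-1` interior zeros there is
`M > 1` with `|u_ε(1)| < M` and `ρ_{1,ε} < 1 - 1/M` for all small `ε > 0`. -/
theorem neumann_bounds (n m : ℕ) (hn : 3 ≤ n) (hm : 2 ≤ m)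
    (u : ℝ → ℝ → ℝ) (ρ δ : ℝ → ℕ → ℝ)
    (hu : ∀ ε ∈ Set.Ioo (0 : ℝ) (4 / ((n : ℝ) - 2)),
      NeumannData n (pEps n ε) m (u ε) (ρ ε) (δ ε)) :
    ∃ M : ℝ, 1 < M ∧ ∃ ε₀ ∈ Set.Ioo (0 : ℝ) (4 / ((n : ℝ) - 2)),
      ∀ ε ∈ Set.Ioo (0 : ℝ) ε₀, |u ε 1| < M ∧ ρ ε 1 < 1 - 1 / M := by
  have hn3 : (3 : ℝ) ≤ n := by exact_mod_cast hn
  have hn2 : (0 : ℝ) < (n : ℝ) - 2 := by linarith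
  have hm0 : (0 : ℝ) < m := by exact_mod_cast (by omega : 0 < m)
  set l : ℝ := 1 / (16 * m) with hl
  have hl0 : 0 < l := by positivity
  set k : ℝ := (1 / 2) ^ (n - 1) with hk
  have hk0 : 0 < k := by positivity
  have hk1 : k ≤ 1 := pow_le_one₀ (by norm_num) (by norm_num)
  set D : ℝ := 2 / (k * k * (l / 2) ^ 2) with hD
  set K : ℝ := 2 * D ^ n / k / (k * l) with hK
  have hD0 : 0 < D := by positivity
  have hK0 : 0 < K := by positivity
  set Q : ℝ := 4 * K ^ 6 + 1 with hQ
  have hQ1 : 1 < Q := by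
    have : 0 < K ^ 6 := by positivity
    linarith
  have hQ4 : Q ≤ Q ^ 4 := le_self_pow₀ hQ1.le (by norm_num)
  have hM4 : Q ^ 4 ≤ Q ^ 4 / k := by
    rw [le_div_iff₀ hk0]; nlinarith
  have hM : 4 < Q ^ 4 / k + 4 := by linarith
  refine ⟨Q ^ 4 / k + 4, by linarith, 2 / ((n : ℝ) - 2), ⟨by positivity, ?_⟩, ?_⟩
  · exact div_lt_div_of_pos_right (by norm_num) hn2
  intro ε hε
  have hε' : ε ∈ Set.Ioo (0 : ℝ) (4 / ((n : ℝ) - 2)) :=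
    ⟨hε.1, hε.2.trans (div_lt_div_of_pos_right (by norm_num) hn2)⟩
  have hdat := hu ε hε'
  obtain ⟨hu1, hv1⟩ := neumann_end hm hdat
  have sys := sys_of_sol hdat.1
  have hpe : pEps n ε - 1 = 4 / ((n : ℝ) - 2) - ε := by
    unfold pEps; field_simp; ring
  have h42 : 4 / ((n : ℝ) - 2) = 2 / ((n : ℝ) - 2) + 2 / ((n : ℝ) - 2) := by ring
  have h20 : 0 < 2 / ((n : ℝ) - 2) := by positivity
  have hplow : 2 / ((n : ℝ) - 2) ≤ pEps n ε - 1 := by linarith [hε.2]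
  have h44 : 4 / ((n : ℝ) - 2) ≤ 4 := by
    rw [div_le_iff₀ hn2]; linarith
  have hp : 1 < pEps n ε := by linarith
  have hp5 : pEps n ε ≤ 5 := by linarith [hε.1]
  have hnp : 1 ≤ (pEps n ε - 1) * n := by
    have h1 : 2 / ((n : ℝ) - 2) * ((n : ℝ) - 2) = 2 := by field_simp
    nlinarith
  obtain ⟨-, -, -, -, -, -, hZ, -⟩ := hdat
  obtain ⟨c, hc1, hc2, hc3⟩ := exists_free hm (ρ ε)
  have hb := sys.bound hp hp5 hnp c l k D K hl0 hc1 (by linarith) (fun r hr h0 => by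
    apply hc3 r hr
    rw [← hZ]
    exact ⟨⟨by linarith [hr.1], by linarith [hr.2]⟩, h0⟩) hk hD hK
  have hb' : ∀ r ∈ Icc (3 / 4 : ℝ) 1, |u ε r| ≤ Q := fun r hr => by
    have := hb r ⟨by linarith [hr.1], hr.2⟩
    linarith
  have hρmem : ρ ε 1 ∈ {r : ℝ | r ∈ Set.Ioo (0 : ℝ) 1 ∧ u ε r = 0} := by
    rw [hZ]; exact ⟨1, ⟨le_rfl, by omega⟩, rfl⟩
  constructor
  · linarith [hb' 1 ⟨by norm_num, le_rfl⟩]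
  · have hMpos : 0 < Q ^ 4 / k + 4 := by linarith
    have goal' : 1 / (Q ^ 4 / k + 4) < 1 - ρ ε 1 := by
      rw [div_lt_iff₀ hMpos]
      rcases le_or_gt (3 / 4) (ρ ε 1) with h1 | h1
      · have hg := sys.gap hp hp5 (ρ ε 1) Q (by linarith) hρmem.1.2 hρmem.2 hu1 hv1 hQ1.le
          (fun r hr => hb' r ⟨h1.trans hr.1, hr.2⟩)
        rw [← hk] at hg
        have h2 : 1 ≤ Q ^ 4 / k * (1 - ρ ε 1) := by
          rw [div_mul_eq_mul_div, le_div_iff₀ hk0]; linarith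
        nlinarith [hρmem.1.2]
      · nlinarith
    linarith
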